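/- Let q : ℝ → ℝⁿ be twice differentiable, M : ℝ → Matrix (Fin n) (Fin n) ℝ differentiable with M(t) symmetric, C, D : ℝ → Matrix (Fin n) (Fin n) ℝ with D(t) positive semidefinite for every t, K_p symmetric, K_D symmetric positive definite, and q^d ∈ ℝⁿ. Assume for every t: (i) q̇(t)ᵀ (M'(t) − 2C(t)) q̇(t) = 0, and (ii) the fluid-actuated closed-loop dynamics M(t) q̈(t) = u(t) − (C(t) + D(t)) q̇(t) with u(t) = −K_p (q(t) − q^d) − K_D q̇(t). Then V(t) := ½ q̇ᵀ M q̇ + ½ (q − q^d)ᵀ K_p (q − q^d) satisfies V'(t) = −q̇(t)ᵀ (K_D + D(t)) q̇(t) ≤ 0 for every t. -/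

import Mathlib

open Matrix

/-- Product rule for the dot product of two curves in `ℝᵐ`. -/
theorem hasDerivAt_dotProduct {m : Type*} [Fintype m] {v w : ℝ → m → ℝ} {v' w' : m → ℝ} {t : ℝ}
    (hv : HasDerivAt v v' t) (hw : HasDerivAt w w' t) :
    HasDerivAt (fun s => v s ⬝ᵥ w s) (v' ⬝ᵥ w t + v t ⬝ᵥ w') t := by
  simp only [dotProduct, ← Finset.sum_add_distrib]
  exact HasDerivAt.fun_sum fun i _ => (hasDerivAt_pi.1 hv i).mul (hasDerivAt_pi.1 hw i)

/-- Product rule for a curve of matrices, differentiable entrywise, acting on a curve of vectors. -/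
theorem hasDerivAt_mulVec {l m : Type*} [Fintype l] [Fintype m] {A : ℝ → Matrix l m ℝ}
    {A' : Matrix l m ℝ} {v : ℝ → m → ℝ} {v' : m → ℝ} {t : ℝ}
    (hA : ∀ i j, HasDerivAt (fun s => A s i j) (A' i j) t) (hv : HasDerivAt v v' t) :
    HasDerivAt (fun s => A s *ᵥ v s) (A' *ᵥ v t + A t *ᵥ v') t :=
  hasDerivAt_pi.2 fun i => hasDerivAt_dotProduct (hasDerivAt_pi.2 (hA i)) hv

/-- A symmetric matrix defines a symmetric bilinear form. -/
theorem Matrix.IsSymm.dotProduct_mulVec_comm {m : Type*} [Fintype m] {A : Matrix m m ℝ}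
    (hA : A.IsSymm) (v w : m → ℝ) : v ⬝ᵥ (A *ᵥ w) = w ⬝ᵥ (A *ᵥ v) := by
  rw [dotProduct_mulVec, ← mulVec_transpose, hA.eq, dotProduct_comm]

/-- The derivative of the quadratic form of a moving symmetric matrix along a curve. -/
theorem hasDerivAt_half_quadraticForm {m : Type*} [Fintype m] {A : ℝ → Matrix m m ℝ}
    {A' : Matrix m m ℝ} {v : ℝ → m → ℝ} {v' : m → ℝ} {t : ℝ} (hsymm : (A t).IsSymm)
    (hA : ∀ i j, HasDerivAt (fun s => A s i j) (A' i j) t) (hv : HasDerivAt v v' t) :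
    HasDerivAt (fun s => (1 / 2) * (v s ⬝ᵥ (A s *ᵥ v s)))
      ((1 / 2) * (v t ⬝ᵥ (A' *ᵥ v t)) + v t ⬝ᵥ (A t *ᵥ v')) t := by
  refine ((hasDerivAt_dotProduct hv (hasDerivAt_mulVec hA hv)).const_mul (1 / 2 : ℝ)).congr_deriv ?_
  rw [dotProduct_add, hsymm.dotProduct_mulVec_comm v' (v t)]
  ring

/-- Corollary for fluid-driven actuation: without the cable tip-load term
(`F = 0`), the PD law `u = −K_p q̃ − K_D q̇` gives
`V'(t) = −q̇ᵀ (K_D + D) q̇ ≤ 0` for the Lyapunov function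
`V(t) = ½ q̇ᵀ M q̇ + ½ q̃ᵀ K_p q̃`. -/
theorem lyapunov_decrease_pd_fluid
    (n : ℕ)
    (q qdot qddot : ℝ → Fin n → ℝ)
    (M Mdot C D : ℝ → Matrix (Fin n) (Fin n) ℝ)
    (u : ℝ → Fin n → ℝ)
    (Kp KD : Matrix (Fin n) (Fin n) ℝ)
    (hKp : Kp.IsSymm) (hKD : KD.PosDef)
    (qd : Fin n → ℝ)
    (hq : ∀ t, HasDerivAt q (qdot t) t)
    (hqdot : ∀ t, HasDerivAt qdot (qddot t) t)
    (hM : ∀ t i j, HasDerivAt (fun s => M s i j) (Mdot t i j) t)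
    (hMsymm : ∀ t, (M t).IsSymm)
    (hD : ∀ t, (D t).PosSemidef)
    (hskew : ∀ t, qdot t ⬝ᵥ ((Mdot t - (2 : ℝ) • C t) *ᵥ qdot t) = 0)
    (heom : ∀ t, M t *ᵥ qddot t = u t - (C t + D t) *ᵥ qdot t)
    (hu : ∀ t, u t = -(Kp *ᵥ (q t - qd)) - KD *ᵥ qdot t) :
    ∀ t, HasDerivAt
      (fun s => (1 / 2) * (qdot s ⬝ᵥ (M s *ᵥ qdot s))
        + (1 / 2) * ((q s - qd) ⬝ᵥ (Kp *ᵥ (q s - qd))))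
      (-(qdot t ⬝ᵥ ((KD + D t) *ᵥ qdot t))) t
      ∧ -(qdot t ⬝ᵥ ((KD + D t) *ᵥ qdot t)) ≤ 0 := by
  intro t
  constructor
  · have hKin := hasDerivAt_half_quadraticForm (hMsymm t) (hM t) (hqdot t)
    have hPot := hasDerivAt_half_quadraticForm (A := fun _ => Kp) (A' := 0) hKp
      (fun _ _ => hasDerivAt_const t _) ((hq t).sub_const qd)
    refine (hKin.add hPot).congr_deriv ?_
    have hs := hskew t
    simp only [sub_mulVec, smul_mulVec, dotProduct_sub, dotProduct_smul, smul_eq_mul] at hs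
    rw [heom t, hu t, hKp.dotProduct_mulVec_comm (q t - qd) (qdot t)]
    simp only [add_mulVec, dotProduct_sub, dotProduct_add, dotProduct_neg, zero_mulVec,
      dotProduct_zero]
    linarith
  · have h := (hKD.posSemidef.add (hD t)).dotProduct_mulVec_nonneg (qdot t)
    rw [star_trivial] at h
    exact neg_nonpos.2 h
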